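/- Let I be the ideal of R generated by x2^{a12}x4^{a14}, x2^{a2}, x3^{a3} − x1^{a31}x4^{a34}, x4^{a4}, x3^{a23}x4^{a14}. Then the sequence 0 → R^2 →(φ3) R^6 →(φ2) R^5 →(φ1) R → R/I → 0 is exact, and it is a minimal free resolution of R/I. Here φ1 = (x2^{a12}x4^{a14}, x2^{a2}, x3^{a3}−x1^{a31}x4^{a34}, x4^{a4}, x3^{a23}x4^{a14}); φ2 is the 5×6 matrix with rows (0, 0, x3^{a23}, x4^{a34}, x2^{a42}, 0), (0, −x3^{a3}+x1^{a31}x4^{a34}, 0, 0, −x4^{a14}, 0), (x4^{a14}, x2^{a2}, 0, 0, 0, 0), (x1^{a31}, 0, 0, −x2^{a12}, 0, −x3^{a23}), (−x3^{a43}, 0, −x2^{a12}, 0, 0, x4^{a34}); and φ3 is the 6×2 matrix with rows (x2^{a2}, 0), (−x4^{a14}, 0), (−x2^{a42}x3^{a43}, x4^{a34}), (x1^{a31}x2^{a42}, −x3^{a23}), (x3^{a3}−x1^{a31}x4^{a34}, 0), (0, x2^{a12}). -/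

import Mathlib

open MvPolynomial Matrix

/-- A power of one variable is a nonzerodivisor modulo powers of two other variables. -/
theorem MvPolynomial.mem_span_pair_X_pow_of_X_pow_mul_mem {σ k : Type*} [Field k]
    {i j l : σ} (hi : i ≠ l) (hj : j ≠ l) {a b n : ℕ} {v : MvPolynomial σ k}
    (h : X l ^ n * v ∈ Ideal.span {(X i ^ a : MvPolynomial σ k), X j ^ b}) :
    v ∈ Ideal.span {(X i ^ a : MvPolynomial σ k), X j ^ b} := by
  classical
  have hs : ({X i ^ a, X j ^ b} : Set (MvPolynomial σ k)) =
      (fun s => monomial s (1 : k)) '' {Finsupp.single i a, Finsupp.single j b} := by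
    simp [Set.image_pair, X_pow_eq_monomial]
  rw [hs, mem_ideal_span_monomial_image] at h ⊢
  intro d hd
  obtain ⟨s, hs, hle⟩ := h (Finsupp.single l n + d) (by
    rw [mem_support_iff] at hd ⊢
    rwa [X_pow_eq_monomial, coeff_monomial_mul, one_mul])
  refine ⟨s, hs, ?_⟩
  rcases hs with rfl | rfl
  · simpa [hi.symm, Finsupp.single_apply] using hle
  · simpa [hj.symm, Finsupp.single_apply] using hle

/-- A power of a variable dividing a product with a power of another variable divides the
cofactor. -/
theorem MvPolynomial.X_pow_dvd_of_dvd_X_pow_mul {σ k : Type*} [Field k]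
    {i j : σ} (hij : i ≠ j) {a b : ℕ} {v : MvPolynomial σ k} (h : X i ^ a ∣ X j ^ b * v) :
    X i ^ a ∣ v := by
  rw [← Ideal.mem_span_singleton, ← Set.pair_eq_singleton] at h ⊢
  exact mem_span_pair_X_pow_of_X_pow_mul_mem hij hij h

open MvPolynomial Matrix
theorem gorenstein_tangent_cone_resolution_case_3a_stmt12
    (k : Type*) [Field k]
    (a21 a31 a12 a42 a23 a43 a14 a34 a1 a2 a3 a4 : ℕ)
    (h21 : 0 < a21)
    (h31 : 0 < a31)
    (h12 : 0 < a12)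
    (h42 : 0 < a42)
    (h23 : 0 < a23)
    (h43 : 0 < a43)
    (h14 : 0 < a14)
    (h34 : 0 < a34)
    (ha1 : a1 = a21 + a31)
    (ha2 : a2 = a12 + a42)
    (ha3 : a3 = a23 + a43)
    (ha4 : a4 = a14 + a34)
    (hc1 : a12 + a14 < a1)
    (hc2 : a4 < a42 + a43)
    (hc3 : a2 ≤ a21 + a23)
    (hc4 : a3 ≤ a31 + a34)
    (x1 x2 x3 x4 : MvPolynomial (Fin 4) k)
    (hx1 : x1 = X 0) (hx2 : x2 = X 1) (hx3 : x3 = X 2) (hx4 : x4 = X 3)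
    (I m : Ideal (MvPolynomial (Fin 4) k))
    (hI : I = Ideal.span {x2 ^ a12 * x4 ^ a14, x2 ^ a2, x3 ^ a3 - x1 ^ a31 * x4 ^ a34, x4 ^ a4, x3 ^ a23 * x4 ^ a14})
    (hm : m = Ideal.span {x1, x2, x3, x4})
    (g : Fin 5 → MvPolynomial (Fin 4) k)
    (hg : g = ![x2 ^ a12 * x4 ^ a14, x2 ^ a2, x3 ^ a3 - x1 ^ a31 * x4 ^ a34, x4 ^ a4, x3 ^ a23 * x4 ^ a14])
    (φ1 : (Fin 5 → MvPolynomial (Fin 4) k) →ₗ[MvPolynomial (Fin 4) k]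
      MvPolynomial (Fin 4) k)
    (hφ1 : ∀ v, φ1 v = ∑ i, v i * g i)
    (M2 : Matrix (Fin 5) (Fin 6) (MvPolynomial (Fin 4) k))
    (hM2 : M2 = !![0, 0, x3 ^ a23, x4 ^ a34, x2 ^ a42, 0;
      0, -x3 ^ a3 + x1 ^ a31 * x4 ^ a34, 0, 0, -x4 ^ a14, 0;
      x4 ^ a14, x2 ^ a2, 0, 0, 0, 0;
      x1 ^ a31, 0, 0, -x2 ^ a12, 0, -x3 ^ a23;
      -x3 ^ a43, 0, -x2 ^ a12, 0, 0, x4 ^ a34])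
    (M3 : Matrix (Fin 6) (Fin 2) (MvPolynomial (Fin 4) k))
    (hM3 : M3 = !![x2 ^ a2, 0;
      -x4 ^ a14, 0;
      -(x2 ^ a42 * x3 ^ a43), x4 ^ a34;
      x1 ^ a31 * x2 ^ a42, -x3 ^ a23;
      x3 ^ a3 - x1 ^ a31 * x4 ^ a34, 0;
      0, x2 ^ a12]) :
    Function.Injective ⇑M3.mulVecLin ∧
    Function.Exact ⇑M3.mulVecLin ⇑M2.mulVecLin ∧
    Function.Exact ⇑M2.mulVecLin ⇑φ1 ∧
    LinearMap.range φ1 = I ∧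
    Function.Surjective (Ideal.Quotient.mk I) ∧
    (∀ i, g i ∈ m) ∧ (∀ i j, M2 i j ∈ m) ∧ (∀ i j, M3 i j ∈ m) := by
  have hf {v} (h : (x3 ^ a3 - x1 ^ a31 * x4 ^ a34) * v ∈ Ideal.span {x2 ^ a2, x4 ^ a14}) :
      v ∈ Ideal.span {x2 ^ a2, x4 ^ a14} := by
    have hn : (x1 ^ a31 * x4 ^ a34) ^ a14 ∈ Ideal.span {x2 ^ a2, x4 ^ a14} := by
      refine Ideal.mem_of_dvd _ ?_ (Ideal.subset_span (Set.mem_insert_of_mem _ rfl))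
      rw [mul_pow, ← pow_mul x4]
      exact (pow_dvd_pow _ (Nat.le_mul_of_pos_left _ h34)).mul_left _
    have hd := Ideal.mem_of_dvd _ (mul_dvd_mul_right
      (sub_dvd_pow_sub_pow (x3 ^ a3) (x1 ^ a31 * x4 ^ a34) a14) v) h
    have hp := Ideal.add_mem _ hd (Ideal.mul_mem_right v _ hn)
    rw [← add_mul, sub_add_cancel, ← pow_mul] at hp
    subst hx2 hx3 hx4
    exact mem_span_pair_X_pow_of_X_pow_mul_mem (by decide) (by decide) hp
  have hB {n v} (h : x3 ^ n * v ∈ Ideal.span {x2 ^ a12, x4 ^ a34}) :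
      v ∈ Ideal.span {x2 ^ a12, x4 ^ a34} := by
    subst hx2 hx3 hx4
    exact mem_span_pair_X_pow_of_X_pow_mul_mem (by decide) (by decide) h
  have h42' {n r v} (h : x4 ^ n ∣ x2 ^ r * v) : x4 ^ n ∣ v := by
    subst hx2 hx4; exact X_pow_dvd_of_dvd_X_pow_mul (by decide) h
  have h43' {n r v} (h : x4 ^ n ∣ x3 ^ r * v) : x4 ^ n ∣ v := by
    subst hx3 hx4; exact X_pow_dvd_of_dvd_X_pow_mul (by decide) h
  have n2 (n) : x2 ^ n ≠ 0 := by subst hx2; exact pow_ne_zero _ (X_ne_zero _)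
  have n4 (n) : x4 ^ n ≠ 0 := by subst hx4; exact pow_ne_zero _ (X_ne_zero _)
  have m1 {n} (h : 0 < n) : x1 ^ n ∈ m :=
    Ideal.pow_mem_of_mem _ (hm ▸ Ideal.subset_span (by simp)) n h
  have m2 {n} (h : 0 < n) : x2 ^ n ∈ m :=
    Ideal.pow_mem_of_mem _ (hm ▸ Ideal.subset_span (by simp)) n h
  have m3 {n} (h : 0 < n) : x3 ^ n ∈ m :=
    Ideal.pow_mem_of_mem _ (hm ▸ Ideal.subset_span (by simp)) n h
  have m4 {n} (h : 0 < n) : x4 ^ n ∈ m :=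
    Ideal.pow_mem_of_mem _ (hm ▸ Ideal.subset_span (by simp)) n h
  have p2 : 0 < a2 := by omega
  have p3 : 0 < a3 := by omega
  have p4 : 0 < a4 := by omega
  have mf : x3 ^ a3 - x1 ^ a31 * x4 ^ a34 ∈ m :=
    Ideal.sub_mem _ (m3 p3) (Ideal.mul_mem_right _ _ (m1 h31))
  have mf' : -x3 ^ a3 + x1 ^ a31 * x4 ^ a34 ∈ m :=
    Ideal.add_mem _ (neg_mem (m3 p3)) (Ideal.mul_mem_right _ _ (m1 h31))
  have e2 : x2 ^ a2 = x2 ^ a12 * x2 ^ a42 := by rw [ha2, pow_add]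
  have e3 : x3 ^ a3 = x3 ^ a23 * x3 ^ a43 := by rw [ha3, pow_add]
  have e4 : x4 ^ a4 = x4 ^ a14 * x4 ^ a34 := by rw [ha4, pow_add]
  refine ⟨?_, ?_, ?_, ?_, Ideal.Quotient.mk_surjective, ?_, ?_, ?_⟩
  · rw [injective_iff_map_eq_zero]
    intro v hv
    rw [mulVecLin_apply, hM3] at hv
    have r1 := congrFun hv 1
    have r5 := congrFun hv 5
    simp [mulVec, dotProduct, Fin.sum_univ_succ, n4, n2] at r1 r5
    ext1 i
    fin_cases i
    · exact r1
    · exact r5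
  · intro w
    simp only [mulVecLin_apply, Set.mem_range, hM2, hM3]
    constructor
    · intro hw
      have r0 := congrFun hw 0
      have r1 := congrFun hw 1
      have r2 := congrFun hw 2
      have r4 := congrFun hw 4
      simp [mulVec, dotProduct, Fin.sum_univ_succ] at r0 r1 r2 r4
      obtain ⟨s, hs⟩ : x4 ^ a14 ∣ w 1 := h42' (r := a2) ⟨-w 0, by linear_combination r2⟩
      have hw0 : w 0 = -x2 ^ a2 * s :=
        mul_left_cancel₀ (n4 a14) (by linear_combination r2 - x2 ^ a2 * hs)
      have hw4 : w 4 = -(x3 ^ a3 - x1 ^ a31 * x4 ^ a34) * s :=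
        mul_left_cancel₀ (n4 a14)
          (by linear_combination -r1 - (x3 ^ a3 - x1 ^ a31 * x4 ^ a34) * hs)
      rw [hw4, e3] at r0
      rw [hw0, e2] at r4
      obtain ⟨t, ht⟩ : x4 ^ a34 ∣ w 2 - x2 ^ a42 * x3 ^ a43 * s :=
        h43' (r := a23) ⟨-w 3 - x1 ^ a31 * x2 ^ a42 * s, by linear_combination r0⟩
      have hw3 : w 3 = -x1 ^ a31 * x2 ^ a42 * s - x3 ^ a23 * t :=
        mul_left_cancel₀ (n4 a34) (by linear_combination r0 - x3 ^ a23 * ht)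
      have hw5 : w 5 = x2 ^ a12 * t :=
        mul_left_cancel₀ (n4 a34) (by linear_combination r4 + x2 ^ a12 * ht)
      refine ⟨![-s, t], ?_⟩
      ext1 i
      fin_cases i <;> simp [mulVec, dotProduct, Fin.sum_univ_succ]
      · linear_combination -hw0
      · linear_combination -hs
      · linear_combination -ht
      · linear_combination -hw3
      · linear_combination -hw4
      · linear_combination -hw5
    · rintro ⟨v, rfl⟩
      ext1 i
      fin_cases i <;> simp [mulVec, dotProduct, Fin.sum_univ_succ, e2, e3] <;> ring
  · intro v
    simp only [mulVecLin_apply, Set.mem_range, hM2, hφ1, hg]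
    constructor
    · intro hv
      simp [Fin.sum_univ_succ] at hv
      rw [e4] at hv
      have hv2 : v 2 ∈ Ideal.span {x2 ^ a2, x4 ^ a14} := hf (Ideal.mem_span_pair.2
        ⟨-v 1, -(v 0 * x2 ^ a12 + v 3 * x4 ^ a34 + v 4 * x3 ^ a23),
          by linear_combination -hv⟩)
      obtain ⟨p, q, hpq⟩ := Ideal.mem_span_pair.1 hv2
      rw [← hpq] at hv
      obtain ⟨u, hu⟩ : x4 ^ a14 ∣ v 1 + (x3 ^ a3 - x1 ^ a31 * x4 ^ a34) * p :=
        h42' (r := a2) ⟨-(v 0 * x2 ^ a12 + v 3 * x4 ^ a34 + v 4 * x3 ^ a23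
          + q * (x3 ^ a3 - x1 ^ a31 * x4 ^ a34)), by linear_combination hv⟩
      have hc : x2 ^ a12 * (v 0 + x2 ^ a42 * u) + x4 ^ a34 * v 3 + x3 ^ a23 * v 4
          + q * (x3 ^ a3 - x1 ^ a31 * x4 ^ a34) = 0 :=
        mul_left_cancel₀ (n4 a14) (by linear_combination hv - x2 ^ a2 * hu - x4 ^ a14 * u * e2)
      rw [e3] at hc
      have hv4 : v 4 + q * x3 ^ a43 ∈ Ideal.span {x2 ^ a12, x4 ^ a34} :=
        hB (n := a23) (Ideal.mem_span_pair.2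
          ⟨-v 0 - x2 ^ a42 * u, q * x1 ^ a31 - v 3, by linear_combination -hc⟩)
      obtain ⟨b, c, hbc⟩ := Ideal.mem_span_pair.1 hv4
      obtain ⟨d, hd⟩ : x4 ^ a34 ∣ v 0 + x2 ^ a42 * u + x3 ^ a23 * b :=
        h42' (r := a12) ⟨-(v 3 - q * x1 ^ a31 + x3 ^ a23 * c), by
          linear_combination hc + x3 ^ a23 * hbc⟩
      have hv3 : v 3 - q * x1 ^ a31 + x3 ^ a23 * c = -x2 ^ a12 * d :=
        mul_left_cancel₀ (n4 a34) (by
          linear_combination hc + x3 ^ a23 * hbc - x2 ^ a12 * hd)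
      refine ⟨![q, p, -b, d, -u, c], ?_⟩
      ext1 i
      fin_cases i <;> simp [mulVec, dotProduct, Fin.sum_univ_succ]
      · linear_combination -hd
      · linear_combination -hu
      · linear_combination hpq
      · linear_combination -hv3
      · linear_combination hbc
    · rintro ⟨w, rfl⟩
      simp [mulVec, dotProduct, Fin.sum_univ_succ, e2, e3, e4]
      ring
  · have : φ1 = Fintype.linearCombination (MvPolynomial (Fin 4) k) g := by
      refine LinearMap.ext fun v => ?_
      simp [hφ1, Fintype.linearCombination_apply]
    rw [this, Fintype.range_linearCombination, hI, hg]
    refine congrArg _ (Set.ext fun p => ?_)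
    simp
    tauto
  · intro i
    subst hg
    fin_cases i
    · exact Ideal.mul_mem_right _ _ (m2 h12)
    · exact m2 p2
    · exact mf
    · exact m4 p4
    · exact Ideal.mul_mem_right _ _ (m3 h23)
  · subst hM2
    intro i j
    fin_cases i <;> fin_cases j <;>
      simp [m1, m2, m3, m4, mf', h31, h12, h42, h23, h43, h14, h34, p2]
  · subst hM3
    intro i j
    fin_cases i <;> fin_cases j <;>
      simp [m2, m3, m4, mf, h12, h23, h14, h34, h42, p2, Ideal.mul_mem_right,
        Ideal.mul_mem_left]
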